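/- Let m be an even positive integer, let ε : [m] → {1,∗}, and for each positive integer N let μ_N be a permutation of [N]×[N] with 𝔧(μ_N : μ_N)/N² → 0 as N → ∞. Define σ_{k,N} = μ_N if ε(k) = 1 and σ_{k,N} = t∘μ_N∘t if ε(k) = ∗. Then for every pair partition π of [m]: V_N(π,(σ_{1,N},…,σ_{m,N})) → 1 as N → ∞ if π is noncrossing and ε(k) ≠ ε(π(k)) for every k ∈ [m], and V_N(π,(σ_{1,N},…,σ_{m,N})) → 0 otherwise. -/

import Mathlib

open Filter Topology

/-- The swap (transpose) map `t(a,b) = (b,a)` on pairs. -/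
def swapPair {α : Type*} : α × α → α × α := fun p => (p.2, p.1)

/-- The conjugation `t ∘ μ ∘ t` of a permutation of pairs by the swap `t`. -/
def conjT {α : Type*} (μ : Equiv.Perm (α × α)) : Equiv.Perm (α × α) :=
  (Equiv.prodComm α α).trans (μ.trans (Equiv.prodComm α α))

/-- `C_N(π, σ⃗)`: the number of tuples `(i₁, …, i_m) ∈ [N]^m` (here `i : Fin m → α`)
such that `σ_k(i_k, i_{k+1}) = t(σ_{π(k)}(i_{π(k)}, i_{π(k)+1}))` for all `k`,
indices read cyclically. -/
noncomputable def pairCount {α : Type*} (m : ℕ) (π : Equiv.Perm (Fin m))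
    (σ : Fin m → Equiv.Perm (α × α)) : ℕ :=
  Nat.card {i : Fin m → α // ∀ k : Fin m,
    σ k (i k, i (finRotate m k)) = swapPair ((σ (π k)) (i (π k), i (finRotate m (π k))))}

/-- `V_N(π, σ⃗) = N^{-m/2-1} C_N(π, σ⃗)`. -/
noncomputable def Vval (m N : ℕ) (π : Equiv.Perm (Fin m))
    (σ : Fin m → Equiv.Perm (Fin N × Fin N)) : ℝ :=
  (pairCount m π σ : ℝ) / (N : ℝ) ^ (m / 2 + 1)

/-- `𝔧(σ : τ) = #{(i,j,k) : σ(i,j) = (t∘τ∘t)(k,j)}`. -/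
noncomputable def jcount {α : Type*} (σ τ : Equiv.Perm (α × α)) : ℕ :=
  Nat.card {x : α × α × α // σ (x.1, x.2.1) = (conjT τ) (x.2.2, x.2.1)}

/-- The count in condition (ii) of the main theorem:
`#{(i,j,k) : σ(i,j) ∈ {μ(i,k), μ(k,j), (t∘μ∘t)(i,k), (t∘μ∘t)(k,j)}}`. -/
noncomputable def mixCount {α : Type*} (σ μ : Equiv.Perm (α × α)) : ℕ :=
  Nat.card {x : α × α × α //
    σ (x.1, x.2.1) = μ (x.1, x.2.2) ∨ σ (x.1, x.2.1) = μ (x.2.2, x.2.1) ∨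
    σ (x.1, x.2.1) = conjT μ (x.1, x.2.2) ∨ σ (x.1, x.2.1) = conjT μ (x.2.2, x.2.1)}

/-- `𝔠(φ, ψ) = #{i : φ(i) = ψ(i)}`. -/
noncomputable def fixCount {α : Type*} (φ ψ : Equiv.Perm α) : ℕ := Nat.card {i : α // φ i = ψ i}

/-- A fixed-point free involution of `{0, …, m - 1}`, as a map on `ℕ`. -/
structure IsPairing (m : ℕ) (p : ℕ → ℕ) : Prop where
  lt : ∀ n < m, p n < m
  invol : ∀ n < m, p (p n) = n
  ne : ∀ n < m, p n ≠ n

/-- The positions on a path of length `m` that are reached first, or by a step that comes before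
its partner. -/
def freePos (m : ℕ) (p : ℕ → ℕ) : Finset ℕ :=
  insert 0 (((Finset.range m).filter (fun n => n < p n)).image Nat.succ)

/-- `f` is a free position from which `n` is reached by steps that are paired among themselves. -/
def IsBase (m : ℕ) (p : ℕ → ℕ) (f n : ℕ) : Prop :=
  f ∈ freePos m p ∧ f ≤ n ∧ ∀ l, f ≤ l → l < n → f ≤ p l ∧ p l < n

/-- The step `k` closes a pair which is crossed, or whose two signs agree. -/
def BadClosing (m : ℕ) (p : ℕ → ℕ) (e : ℕ → Bool) (k : ℕ) : Prop :=
  k < m ∧ p k < k ∧ (e k = e (p k) ∨ ∃ c, p k < c ∧ c < k ∧ ¬(p k < p c ∧ p c < k))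

/-- The path `x` of length `m` satisfies all the pair conditions. -/
def IsSolution {α : Type*} (m : ℕ) (p : ℕ → ℕ) (e : ℕ → Bool) (μ : Equiv.Perm (α × α))
    (x : ℕ → α) : Prop :=
  ∀ k < m, (if e k then conjT μ else μ) (x k, x (k + 1)) =
    swapPair ((if e (p k) then conjT μ else μ) (x (p k), x (p k + 1)))

section Pairing

variable {m : ℕ} {p : ℕ → ℕ} {e : ℕ → Bool}

lemma mem_freePos {n : ℕ} : n ∈ freePos m p ↔ n = 0 ∨ ∃ k < m, k < p k ∧ k + 1 = n := by
  simp [freePos, and_assoc]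

lemma zero_mem_freePos : 0 ∈ freePos m p := mem_freePos.2 (Or.inl rfl)

lemma IsPairing.exists_closing (hp : IsPairing m p) {n : ℕ} (hn : n ≤ m) (h : n ∉ freePos m p) :
    ∃ k < m, p k < k ∧ k + 1 = n := by
  rw [mem_freePos] at h
  push Not at h
  obtain ⟨k, rfl⟩ := Nat.exists_eq_succ_of_ne_zero h.1
  refine ⟨k, by omega, ?_, rfl⟩
  have h1 := hp.ne k (by omega)
  by_contra h2
  exact h.2 k (by omega) (by omega) rfl

lemma IsPairing.two_mul_card_openings (hp : IsPairing m p) :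
    2 * ((Finset.range m).filter (fun n => n < p n)).card = m := by
  have h1 : ((Finset.range m).filter (fun n => n < p n)).card =
      ((Finset.range m).filter (fun n => ¬ n < p n)).card := by
    refine Finset.card_bij' (fun n _ => p n) (fun n _ => p n) ?_ ?_ ?_ ?_
    · intro a ha
      simp only [Finset.mem_filter, Finset.mem_range] at ha ⊢
      have := hp.lt a ha.1
      have := hp.invol a ha.1
      omega
    · intro a ha
      simp only [Finset.mem_filter, Finset.mem_range] at ha ⊢
      have := hp.lt a ha.1
      have := hp.invol a ha.1
      have := hp.ne a ha.1
      omega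
    · intro a ha
      simp only [Finset.mem_filter, Finset.mem_range] at ha
      exact hp.invol a ha.1
    · intro a ha
      simp only [Finset.mem_filter, Finset.mem_range] at ha
      exact hp.invol a ha.1
  have h2 := Finset.card_filter_add_card_filter_not (s := Finset.range m) (fun n => n < p n)
  rw [Finset.card_range] at h2
  omega

lemma IsPairing.card_freePos (hp : IsPairing m p) : (freePos m p).card = m / 2 + 1 := by
  have h := hp.two_mul_card_openings
  rw [freePos, Finset.card_insert_of_notMem (by simp),
    Finset.card_image_of_injective _ Nat.succ_injective]
  omega

lemma IsBase.not_lt (hp : IsPairing m p) {f g n : ℕ} (hf : IsBase m p f n)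
    (hg : IsBase m p g n) : ¬ f < g := by
  intro hlt
  obtain ⟨-, -, hf⟩ := hf
  obtain ⟨hgF, hgn, hg⟩ := hg
  obtain rfl | ⟨k, hkm, hk, rfl⟩ := mem_freePos.1 hgF
  · omega
  · have h1 := hf k (by omega) (by omega)
    have h2 := hg (p k) (by omega) h1.2
    rw [hp.invol k hkm] at h2
    omega

lemma IsBase.unique (hp : IsPairing m p) {f g n : ℕ} (hf : IsBase m p f n)
    (hg : IsBase m p g n) : f = g := by
  have h1 := hf.not_lt hp hg
  have h2 := hg.not_lt hp hf
  omega

lemma isBase_self {n : ℕ} (h : n ∈ freePos m p) : IsBase m p n n :=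
  ⟨h, le_rfl, fun l _ _ => by omega⟩

lemma IsBase.succ_of_closing (hp : IsPairing m p) {f k : ℕ} (hk : k < m) (hpk : p k < k)
    (hgood : ¬ BadClosing m p e k) (hf : IsBase m p f (p k)) : IsBase m p f (k + 1) := by
  obtain ⟨hF, hle, hf⟩ := hf
  refine ⟨hF, by omega, fun l h1 h2 => ?_⟩
  rcases lt_trichotomy l (p k) with h | rfl | h
  · have := hf l h1 h
    omega
  · rw [hp.invol k hk]
    omega
  · obtain h' | rfl := Nat.lt_succ_iff_lt_or_eq.1 h2
    · have : p k < p l ∧ p l < k := by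
        by_contra hc
        exact hgood ⟨hk, hpk, Or.inr ⟨l, h, h', hc⟩⟩
      omega
    · omega

lemma IsPairing.exists_isBase (hp : IsPairing m p) (n : ℕ) (hn : n ≤ m)
    (hgood : ∀ k < n, ¬ BadClosing m p e k) : ∃ f, IsBase m p f n := by
  induction n using Nat.strong_induction_on with
  | _ n ih =>
    by_cases hF : n ∈ freePos m p
    · exact ⟨n, isBase_self hF⟩
    · obtain ⟨k, hk, hpk, rfl⟩ := hp.exists_closing hn hF
      obtain ⟨f, hf⟩ := ih (p k) (by omega) (by omega) fun l hl => hgood l (by omega)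
      exact ⟨f, hf.succ_of_closing hp hk hpk (hgood k (by omega))⟩

lemma BadClosing.exists_minimal {k : ℕ} (hk : BadClosing m p e k) :
    ∃ k, BadClosing m p e k ∧ ∀ l < k, ¬ BadClosing m p e l := by
  classical
  exact ⟨Nat.find ⟨k, hk⟩, Nat.find_spec ⟨k, hk⟩, fun l hl => Nat.find_min ⟨k, hk⟩ hl⟩

section Solution

variable {α : Type*} {μ : Equiv.Perm (α × α)} {x y : ℕ → α}

lemma swapPair_swapPair (u : α × α) : swapPair (swapPair u) = u := rfl

lemma conjT_apply (u : α × α) : conjT μ u = swapPair (μ (swapPair u)) := rfl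

lemma swapPair_injective : Function.Injective (swapPair : α × α → α × α) :=
  Function.LeftInverse.injective swapPair_swapPair

lemma pair_condition_of_ne {a b : Bool} (hab : a ≠ b) (u v : α × α) :
    (if a then conjT μ else μ) u = swapPair ((if b then conjT μ else μ) v) ↔
      u = swapPair v := by
  cases a <;> cases b <;> simp_all [conjT_apply, swapPair_swapPair]
  rw [swapPair_injective.eq_iff, μ.injective.eq_iff, ← swapPair_injective.eq_iff,
    swapPair_swapPair]

/-- A solution is determined by its values at the free positions. -/
lemma IsSolution.eq_of_free (hp : IsPairing m p) (hx : IsSolution m p e μ x)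
    (hy : IsSolution m p e μ y)
    (h : ∀ n ∈ freePos m p, (∀ l < n, x l = y l) → x n = y n) (n : ℕ) (hn : n ≤ m) :
    x n = y n := by
  induction n using Nat.strong_induction_on with
  | _ n ih =>
    by_cases hF : n ∈ freePos m p
    · exact h n hF fun l hl => ih l hl (by omega)
    · obtain ⟨k, hk, hpk, rfl⟩ := hp.exists_closing hn hF
      have h1 := hx k hk
      rw [ih (p k) (by omega) (by omega), ih (p k + 1) (by omega) (by omega), ← hy k hk,
        Equiv.apply_eq_iff_eq] at h1
      exact (Prod.ext_iff.1 h1).2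

lemma IsSolution.eq_base (hp : IsPairing m p) (hx : IsSolution m p e μ x) (n : ℕ) (hn : n ≤ m)
    (hgood : ∀ k < n, ¬ BadClosing m p e k) {f : ℕ} (hf : IsBase m p f n) : x n = x f := by
  induction n using Nat.strong_induction_on generalizing f with
  | _ n ih =>
    by_cases hF : n ∈ freePos m p
    · rw [hf.unique hp (isBase_self hF)]
    · obtain ⟨k, hk, hpk, rfl⟩ := hp.exists_closing hn hF
      have hgood' : ∀ l < p k, ¬ BadClosing m p e l := fun l hl => hgood l (by omega)
      obtain ⟨g, hg⟩ := hp.exists_isBase (p k) (by omega) hgood'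
      have hgk := hgood k (by omega)
      rw [hf.unique hp (hg.succ_of_closing hp hk hpk hgk),
        ← ih (p k) (by omega) (by omega) hgood' hg]
      have hne : e k ≠ e (p k) := fun h => hgk ⟨hk, hpk, Or.inl h⟩
      exact (Prod.ext_iff.1 ((pair_condition_of_ne hne _ _).1 (hx k hk))).2

/-- At the first bad closing, either a free value is already determined by the earlier ones, or
an adjacent pair with equal signs is found after cancelling pairs. -/
lemma BadClosing.base_cases (hp : IsPairing m p) {k f : ℕ} (hk : BadClosing m p e k)
    (hf : IsBase m p f k) : p k + 1 < f ∨ f = p k + 1 ∧ e k = e (p k) := by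
  obtain ⟨hkm, hpk, hbad⟩ := hk
  obtain ⟨hF, hle, hf⟩ := hf
  have h1 : p k < f := by
    by_contra hc
    have := hf (p k) (by omega) hpk
    rw [hp.invol k hkm] at this
    omega
  obtain h2 | rfl := Nat.lt_or_eq_of_le (Nat.succ_le_of_lt h1)
  · exact Or.inl h2
  · refine Or.inr ⟨rfl, hbad.resolve_right ?_⟩
    rintro ⟨c, hc1, hc2, hc⟩
    exact hc (hf c hc1 hc2)

lemma IsSolution.eq_of_crossed (hp : IsPairing m p) (hx : IsSolution m p e μ x)
    (hy : IsSolution m p e μ y) {k f : ℕ} (hk : BadClosing m p e k)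
    (hgood : ∀ l < k, ¬ BadClosing m p e l) (hf : IsBase m p f k) (hlt : p k + 1 < f)
    (h : ∀ n ∈ (freePos m p).erase f, x n = y n) (n : ℕ) (hn : n ≤ m) : x n = y n := by
  refine hx.eq_of_free hp hy (fun n hF hlo => ?_) n hn
  by_cases hnf : n = f
  · subst hnf
    rw [← hx.eq_base hp k hk.1.le hgood hf, ← hy.eq_base hp k hk.1.le hgood hf]
    have h1 := hx k hk.1
    rw [hlo _ hlt, hlo (p k) (by omega), ← hy k hk.1, Equiv.apply_eq_iff_eq] at h1
    exact (Prod.ext_iff.1 h1).1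
  · exact h n (Finset.mem_erase.2 ⟨hnf, hF⟩)

lemma IsSolution.eq_of_adjacent (hp : IsPairing m p) (hx : IsSolution m p e μ x)
    (hy : IsSolution m p e μ y) {q g : ℕ} (hq : q ≤ m)
    (hgood : ∀ l < q, ¬ BadClosing m p e l) (hg : IsBase m p g q)
    (h0 : x q = y q) (h1 : x (q + 1) = y (q + 1))
    (h : ∀ n ∈ ((freePos m p).erase g).erase (q + 1), x n = y n) (n : ℕ) (hn : n ≤ m) :
    x n = y n := by
  refine hx.eq_of_free hp hy (fun n hF _ => ?_) n hn
  by_cases hng : n = g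
  · subst hng
    rw [← hx.eq_base hp q hq hgood hg, ← hy.eq_base hp q hq hgood hg, h0]
  by_cases hnq : n = q + 1
  · rw [hnq, h1]
  · exact h n (Finset.mem_erase.2 ⟨hnq, Finset.mem_erase.2 ⟨hng, hF⟩⟩)

/-- If no closing is bad, the values at the free positions extend to a closed solution. -/
lemma IsPairing.exists_isSolution (hp : IsPairing m p) (hgood : ∀ k, ¬ BadClosing m p e k)
    (μ : Equiv.Perm (α × α)) (g : ℕ → α) :
    ∃ x : ℕ → α, IsSolution m p e μ x ∧ x m = x 0 ∧ ∀ n ∈ freePos m p, n ≤ m → x n = g n := by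
  have hex : ∀ n, ∃ f, n ≤ m → IsBase m p f n := fun n => by
    by_cases hn : n ≤ m
    · obtain ⟨f, hf⟩ := hp.exists_isBase n hn fun k _ => hgood k
      exact ⟨f, fun _ => hf⟩
    · exact ⟨0, fun h => absurd h hn⟩
  choose r hr using hex
  have heq : ∀ {n f}, n ≤ m → IsBase m p f n → r n = f := fun hn hf => (hr _ hn).unique hp hf
  have hclose : ∀ k < m, p k < k → r (k + 1) = r (p k) ∧ r k = r (p k + 1) := by
    intro k hk hpk
    refine ⟨heq hk ((hr (p k) (by omega)).succ_of_closing hp hk hpk (hgood k)), ?_⟩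
    have hF : p k + 1 ∈ freePos m p :=
      mem_freePos.2 (Or.inr ⟨p k, by omega, by rwa [hp.invol k hk], rfl⟩)
    rw [heq (by omega) (isBase_self hF)]
    refine heq hk.le ⟨hF, hpk, fun l h1 h2 => ?_⟩
    by_contra hc
    exact hgood k ⟨hk, hpk, Or.inr ⟨l, h1, h2, hc⟩⟩
  refine ⟨fun n => g (r n), fun k hk => ?_, ?_, fun n hF hn => ?_⟩
  · have hne : e k ≠ e (p k) := fun h => by
      rcases lt_or_gt_of_ne (hp.ne k hk) with hlt | hlt
      · exact hgood k ⟨hk, hlt, Or.inl h⟩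
      · exact hgood (p k) ⟨hp.lt k hk, by rwa [hp.invol k hk],
          Or.inl (by rw [hp.invol k hk, h])⟩
    rw [pair_condition_of_ne hne]
    rcases lt_or_gt_of_ne (hp.ne k hk) with hlt | hlt
    · obtain ⟨h1, h2⟩ := hclose k hk hlt
      simp only [h1, h2, swapPair]
    · obtain ⟨h1, h2⟩ := hclose (p k) (hp.lt k hk) (by rwa [hp.invol k hk])
      rw [hp.invol k hk] at h1 h2
      simp only [h1, h2, swapPair]
  · have h0 : IsBase m p 0 m :=
      ⟨zero_mem_freePos, Nat.zero_le _, fun l _ hl => ⟨Nat.zero_le _, hp.lt l hl⟩⟩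
    simp only [heq le_rfl h0, heq (Nat.zero_le m) (isBase_self zero_mem_freePos)]
  · simp only [heq hn (isBase_self hF)]

lemma le_of_mem_freePos {n : ℕ} (h : n ∈ freePos m p) : n ≤ m := by
  obtain rfl | ⟨k, hk, -, rfl⟩ := mem_freePos.1 h
  · exact Nat.zero_le m
  · exact hk

/-- A closing adjacent to its partner with the same sign gives a triple counted by `jcount`. -/
lemma jcount_condition (hx : IsSolution m p e μ x) {k : ℕ}
    (hk : k < m) (hadj : x k = x (p k + 1)) (he : e k = e (p k)) :
    let t : α × α × α := if e k then (x (k + 1), x (p k + 1), x (p k))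
      else (x (p k), x (p k + 1), x (k + 1))
    μ (t.1, t.2.1) = conjT μ (t.2.2, t.2.1) := by
  have h := hx k hk
  rw [← he, hadj] at h
  cases hb : e k
  · simp only [hb, Bool.false_eq_true, if_false] at h ⊢
    rw [conjT_apply]
    exact (congrArg swapPair h).symm
  · simp only [hb, if_true] at h ⊢
    exact congrArg swapPair h

end Solution

end Pairing

section Count

variable {m : ℕ} [NeZero m] {α : Type*}

/-- The closed path through the entries of a cyclic tuple. -/
def cyclicPath (i : Fin m → α) (n : ℕ) : α := i (Fin.ofNat m n)

/-- A permutation of `Fin m` as a map on `ℕ`, extended periodically. -/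
def natPairing (π : Equiv.Perm (Fin m)) (n : ℕ) : ℕ := π (Fin.ofNat m n)


lemma ofNat_val (k : Fin m) : Fin.ofNat m k = k := Fin.ext (Nat.mod_eq_of_lt k.2)

lemma natPairing_val (π : Equiv.Perm (Fin m)) (k : Fin m) : natPairing π k = π k := by
  rw [natPairing, ofNat_val]

lemma finRotate_eq_ofNat (k : Fin m) : finRotate m k = Fin.ofNat m (k + 1) := by
  obtain ⟨n, rfl⟩ := Nat.exists_eq_succ_of_ne_zero (NeZero.ne m)
  rw [finRotate_apply]
  ext
  simp [Fin.val_add]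

lemma isPairing_natPairing {π : Equiv.Perm (Fin m)} (hinv : ∀ k, π (π k) = k)
    (hfix : ∀ k, π k ≠ k) : IsPairing m (natPairing π) where
  lt n _ := Fin.is_lt _
  invol n hn := by
    rw [natPairing, natPairing, ofNat_val, hinv]
    exact Nat.mod_eq_of_lt hn
  ne n hn h := hfix ⟨n, hn⟩ (Fin.ext ((natPairing_val π ⟨n, hn⟩).symm.trans h))

/-- The tuples counted by `pairCount` are the solutions among closed paths. -/
lemma pairCount_condition_iff (π : Equiv.Perm (Fin m)) (ε : Fin m → Bool)
    (μ : Equiv.Perm (α × α)) (i : Fin m → α) :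
    (∀ k : Fin m, (if ε k then conjT μ else μ) (i k, i (finRotate m k)) =
      swapPair ((if ε (π k) then conjT μ else μ) (i (π k), i (finRotate m (π k))))) ↔
    IsSolution m (natPairing π) (fun n => ε (Fin.ofNat m n)) μ (cyclicPath i) := by
  have key : ∀ k : Fin m, ((if ε (Fin.ofNat m k) then conjT μ else μ)
      (cyclicPath i k, cyclicPath i (k + 1)) =
      swapPair ((if ε (Fin.ofNat m (natPairing π k)) then conjT μ else μ)
        (cyclicPath i (natPairing π k), cyclicPath i (natPairing π k + 1)))) ↔
      ((if ε k then conjT μ else μ) (i k, i (finRotate m k)) =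
      swapPair ((if ε (π k) then conjT μ else μ) (i (π k), i (finRotate m (π k))))) := by
    intro k
    simp only [cyclicPath, natPairing_val, ofNat_val, finRotate_eq_ofNat]
  exact ⟨fun h k hk => (key ⟨k, hk⟩).2 (h ⟨k, hk⟩), fun h k => (key k).1 (h k k.2)⟩

lemma cyclicPath_val (i : Fin m → α) (k : Fin m) : cyclicPath i k = i k := by
  rw [cyclicPath, ofNat_val]

lemma pairCount_eq_card (π : Equiv.Perm (Fin m)) (ε : Fin m → Bool) (μ : Equiv.Perm (α × α)) :
    pairCount m π (fun k => if ε k then conjT μ else μ) =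
      Nat.card {i : Fin m → α //
        IsSolution m (natPairing π) (fun n => ε (Fin.ofNat m n)) μ (cyclicPath i)} :=
  Nat.card_congr (Equiv.subtypeEquivRight (pairCount_condition_iff π ε μ))

lemma cyclicPath_injective_on {i j : Fin m → α}
    (h : ∀ n ≤ m, cyclicPath i n = cyclicPath j n) : i = j := by
  funext k
  rw [← cyclicPath_val i, h k k.2.le, cyclicPath_val]

variable {p : ℕ → ℕ} {e : ℕ → Bool} {μ : Equiv.Perm (α × α)}

lemma card_solutions_of_good (hp : IsPairing m p)
    (hgood : ∀ k, ¬ BadClosing m p e k) :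
    Nat.card {i : Fin m → α // IsSolution m p e μ (cyclicPath i)} =
      Nat.card α ^ (m / 2 + 1) := by
  have hb : Function.Bijective
      (fun (i : {i : Fin m → α // IsSolution m p e μ (cyclicPath i)}) (n : freePos m p) =>
        cyclicPath i.1 n) := by
    constructor
    · intro i j hij
      refine Subtype.ext (cyclicPath_injective_on ?_)
      exact i.2.eq_of_free hp j.2 fun n hn _ => congrFun hij ⟨n, hn⟩
    · intro g
      obtain ⟨x, hx, hx0, hxg⟩ := hp.exists_isSolution hgood μ
        (fun n => if h : n ∈ freePos m p then g ⟨n, h⟩ else g ⟨0, zero_mem_freePos⟩)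
      have hc : ∀ n ≤ m, cyclicPath (fun k : Fin m => x k) n = x n := by
        intro n hn
        obtain h | rfl := Nat.lt_or_eq_of_le hn
        · simp [cyclicPath, Nat.mod_eq_of_lt h]
        · simp [cyclicPath, hx0]
      refine ⟨⟨fun k => x k, fun k hk => ?_⟩, funext fun n => ?_⟩
      · have := hp.lt k hk
        rw [hc k hk.le, hc (k + 1) hk, hc (p k) this.le, hc (p k + 1) this]
        exact hx k hk
      · have hn := le_of_mem_freePos n.2
        simp only [hc n hn, hxg n n.2 hn, n.2, dif_pos]
  rw [Nat.card_eq_of_bijective _ hb, Nat.card_fun,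
    Nat.card_eq_fintype_card (α := freePos m p), Fintype.card_coe, hp.card_freePos]

lemma card_solutions_le_of_crossed [Finite α] (hp : IsPairing m p) {k f : ℕ}
    (hk : BadClosing m p e k) (hgood : ∀ l < k, ¬ BadClosing m p e l) (hf : IsBase m p f k)
    (hlt : p k + 1 < f) :
    Nat.card {i : Fin m → α // IsSolution m p e μ (cyclicPath i)} ≤ Nat.card α ^ (m / 2) := by
  have hinj : Function.Injective
      (fun (i : {i : Fin m → α // IsSolution m p e μ (cyclicPath i)})
        (n : (freePos m p).erase f) => cyclicPath i.1 n) := by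
    intro i j hij
    refine Subtype.ext (cyclicPath_injective_on ?_)
    exact i.2.eq_of_crossed hp j.2 hk hgood hf hlt fun n hn => congrFun hij ⟨n, hn⟩
  refine (Nat.card_le_card_of_injective _ hinj).trans_eq ?_
  rw [Nat.card_fun, Nat.card_eq_fintype_card (α := (Finset.erase _ _ : Finset ℕ)),
    Fintype.card_coe, Finset.card_erase_of_mem hf.1, hp.card_freePos, Nat.add_sub_cancel]

lemma card_solutions_le_of_adjacent [Finite α] (hp : IsPairing m p) {k : ℕ}
    (hk : BadClosing m p e k) (hgood : ∀ l < k, ¬ BadClosing m p e l)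
    (hf : IsBase m p (p k + 1) k) (he : e k = e (p k)) :
    Nat.card {i : Fin m → α // IsSolution m p e μ (cyclicPath i)} ≤
      jcount μ μ * Nat.card α ^ (m / 2 - 1) := by
  have hkm := hk.1
  have hpk := hk.2.1
  have hgood' : ∀ l < p k, ¬ BadClosing m p e l := fun l hl => hgood l (by omega)
  obtain ⟨g, hg⟩ := hp.exists_isBase (p k) (by omega) hgood'
  have hinj : Function.Injective
      (fun (i : {i : Fin m → α // IsSolution m p e μ (cyclicPath i)}) =>
        ((⟨_, jcount_condition i.2 hkm (i.2.eq_base hp k hkm.le hgood hf) he⟩,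
          fun n => cyclicPath i.1 n) :
        {x : α × α × α // μ (x.1, x.2.1) = conjT μ (x.2.2, x.2.1)} ×
          (((freePos m p).erase g).erase (p k + 1) → α))) := by
    intro i j hij
    obtain ⟨h1, h2⟩ := Prod.ext_iff.1 hij
    have h1 := congrArg Subtype.val h1
    have h3 : cyclicPath i.1 (p k) = cyclicPath j.1 (p k) ∧
        cyclicPath i.1 (p k + 1) = cyclicPath j.1 (p k + 1) := by
      cases hb : e k <;> simp only [hb, Bool.false_eq_true, if_false, if_true, Prod.mk.injEq] at h1
      · exact ⟨h1.1, h1.2.1⟩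
      · exact ⟨h1.2.2, h1.2.1⟩
    refine Subtype.ext (cyclicPath_injective_on ?_)
    exact i.2.eq_of_adjacent hp j.2 (by omega) hgood' hg h3.1 h3.2
      fun n hn => congrFun h2 ⟨n, hn⟩
  refine (Nat.card_le_card_of_injective _ hinj).trans_eq ?_
  have hne : p k + 1 ≠ g := by
    have := hg.2.1
    omega
  rw [Nat.card_prod, Nat.card_fun, Nat.card_eq_fintype_card (α := (Finset.erase _ _ : Finset ℕ)),
    Fintype.card_coe, Finset.card_erase_of_mem (Finset.mem_erase.2 ⟨hne, hf.1⟩),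
    Finset.card_erase_of_mem hg.1, hp.card_freePos, Nat.add_sub_cancel, jcount]

/-- Bad closings are exactly the obstructions to a noncrossing pairing with opposite signs. -/
lemma exists_badClosing_iff {π : Equiv.Perm (Fin m)} (hinv : ∀ k, π (π k) = k)
    (hfix : ∀ k, π k ≠ k) (ε : Fin m → Bool) :
    (∃ k, BadClosing m (natPairing π) (fun n => ε (Fin.ofNat m n)) k) ↔
      ¬((∀ a b : Fin m, ¬(a < b ∧ b < π a ∧ π a < π b)) ∧ ∀ k, ε k ≠ ε (π k)) := by
  constructor
  · rintro ⟨k, hk, hpk, hbad⟩ ⟨hnc, hε⟩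
    lift k to Fin m using hk
    simp only [natPairing_val, ofNat_val] at hpk hbad
    obtain h | ⟨c, hc1, hc2, hc⟩ := hbad
    · exact hε k h
    · lift c to Fin m using (by omega)
      simp only [natPairing_val] at hc
      have h1 := hnc (π k) c
      have h2 := hnc (π c) (π k)
      have h3 : π c ≠ π k := fun h => by
        have := π.injective h
        omega
      have h4 : π c ≠ k := fun h => by
        have : c = π k := by rw [← h, hinv]
        omega
      simp only [hinv, Fin.lt_def] at h1 h2
      simp only [ne_eq, Fin.ext_iff] at h3 h4
      omega
  · intro h
    by_contra hgood
    push Not at hgood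
    refine h ⟨?_, fun k hk => ?_⟩
    · rintro a b ⟨h1, h2, h3⟩
      refine hgood (π a) ⟨(π a).2, ?_, Or.inr ⟨b, ?_, h2, ?_⟩⟩
      all_goals simp only [natPairing_val, hinv]
      · omega
      · omega
      · omega
    · rcases lt_or_gt_of_ne (hfix k) with hlt | hlt
      · refine hgood k ⟨k.2, ?_, Or.inl ?_⟩
        · simpa only [natPairing_val, Fin.lt_def] using hlt
        · simpa only [natPairing_val, ofNat_val] using hk
      · refine hgood (π k) ⟨(π k).2, ?_, Or.inl ?_⟩
        · simpa only [natPairing_val, hinv, Fin.lt_def] using hlt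
        · simpa only [natPairing_val, ofNat_val, hinv] using hk.symm

end Count

/-- let `ε : [m] → {1, ∗}` (here `Bool`, with `false = 1` and
`true = ∗`), and for each `N` let `μ_N` be a permutation of `[N]²` with
`𝔧(μ_N : μ_N)/N² → 0`. Put `σ_{k,N} = μ_N` if `ε k = 1` and `σ_{k,N} = t∘μ_N∘t`
if `ε k = ∗`. Then for every pair partition `π` of `[m]`: `V_N(π, σ⃗_N) → 1` if
`π` is noncrossing and `ε(k) ≠ ε(π(k))` for every `k`, and `V_N(π, σ⃗_N) → 0`
otherwise. -/
theorem Vval_limit_single_perm (m : ℕ) (hm : Even m) (hm0 : 0 < m)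
    (ε : Fin m → Bool)
    (μ : ∀ N : ℕ, Equiv.Perm (Fin N × Fin N))
    (hμ : Tendsto (fun N : ℕ => (jcount (μ N) (μ N) : ℝ) / (N : ℝ) ^ 2) atTop (nhds 0))
    (π : Equiv.Perm (Fin m)) (hinv : ∀ k, π (π k) = k) (hfix : ∀ k, π k ≠ k) :
    (((∀ a b : Fin m, ¬(a < b ∧ b < π a ∧ π a < π b)) ∧ ∀ k, ε k ≠ ε (π k)) →
      Tendsto (fun N : ℕ =>
          Vval m N π (fun k => if ε k then conjT (μ N) else μ N)) atTop (nhds 1)) ∧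
    (¬((∀ a b : Fin m, ¬(a < b ∧ b < π a ∧ π a < π b)) ∧ ∀ k, ε k ≠ ε (π k)) →
      Tendsto (fun N : ℕ =>
          Vval m N π (fun k => if ε k then conjT (μ N) else μ N)) atTop (nhds 0)) := by
  have : NeZero m := ⟨hm0.ne'⟩
  have hp := isPairing_natPairing hinv hfix
  rw [← exists_badClosing_iff hinv hfix ε]
  constructor
  · intro hnc
    have hgood := not_exists.1 fun h => (exists_badClosing_iff hinv hfix ε).1 h hnc
    refine tendsto_const_nhds.congr' ?_
    filter_upwards [eventually_gt_atTop 0] with N hN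
    rw [Vval, pairCount_eq_card, card_solutions_of_good hp hgood, Nat.card_fin, Nat.cast_pow,
      div_self (by positivity)]
  · rintro ⟨k, hk⟩
    obtain ⟨k, hk, hgood⟩ := hk.exists_minimal
    obtain ⟨f, hf⟩ := hp.exists_isBase k hk.1.le hgood
    obtain hlt | ⟨rfl, he⟩ := hk.base_cases hp hf
    · refine squeeze_zero' (.of_forall fun N => by unfold Vval; positivity) ?_
        (tendsto_one_div_atTop_nhds_zero_nat (𝕜 := ℝ))
      filter_upwards [eventually_gt_atTop 0] with N hN
      have hle := card_solutions_le_of_crossed (μ := μ N) hp hk hgood hf hlt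
      rw [Nat.card_fin] at hle
      rw [Vval, pairCount_eq_card, pow_succ, div_le_div_iff₀ (by positivity) (by positivity),
        one_mul]
      gcongr
      exact_mod_cast hle
    · refine squeeze_zero' (.of_forall fun N => by unfold Vval; positivity) ?_ hμ
      filter_upwards [eventually_gt_atTop 0] with N hN
      have hle := card_solutions_le_of_adjacent (μ := μ N) hp hk hgood hf he
      rw [Nat.card_fin] at hle
      have hm2 : m / 2 + 1 = (m / 2 - 1) + 2 := by
        obtain ⟨r, rfl⟩ := hm
        omega
      rw [Vval, pairCount_eq_card, div_le_div_iff₀ (by positivity) (by positivity), hm2, pow_add,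
        ← mul_assoc]
      gcongr
      exact_mod_cast hle
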